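/- Let A be a finite idempotent algebra. If every pair of triples (s0, s1) ∈ (A² × {0,1})² has a common local difference term operation, then there is a ternary term that is a local difference term operation for the whole set A² × {0,1}, and any such term is a difference term operation for A; in particular, A has a difference term operation. -/

import Mathlib

open FirstOrder FirstOrder.Language FirstOrder.Language.Structure

/-- A congruence on an `L`-structure: an equivalence relation preserved by every
basic operation. -/
def IsCong (L : FirstOrder.Language) (A : Type*) [L.Structure A] (r : A → A → Prop) : Prop :=
  Equivalence r ∧ ∀ (n : ℕ) (f : L.Functions n) (x y : Fin n → A),
    (∀ i, r (x i) (y i)) → r (funMap f x) (funMap f y)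

/-- The congruence generated by a set of pairs: the intersection of all congruences
containing the set. -/
def cgSet (L : FirstOrder.Language) (A : Type*) [L.Structure A] (s : Set (A × A)) :
    A → A → Prop :=
  fun x y => ∀ r : A → A → Prop, IsCong L A r → (∀ p ∈ s, r p.1 p.2) → r x y

/-- `Cg^A(a,b)`: the least congruence containing `(a,b)`. -/
def cgPair (L : FirstOrder.Language) (A : Type*) [L.Structure A] (a b : A) : A → A → Prop :=
  cgSet L A {(a, b)}

/-- The term condition `C(α,β;δ)`. -/
def TermCond (L : FirstOrder.Language) (A : Type*) [L.Structure A]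
    (α β δ : A → A → Prop) : Prop :=
  ∀ (n : ℕ) (t : L.Term (Fin (n + 1))) (a a' : A), α a a' →
    ∀ u v : Fin n → A, (∀ i, β (u i) (v i)) →
      δ (t.realize (Fin.cons a u)) (t.realize (Fin.cons a v)) →
      δ (t.realize (Fin.cons a' u)) (t.realize (Fin.cons a' v))

/-- The commutator `[α,β]`: the least congruence `δ` such that `C(α,β;δ)` holds
(the intersection of all such `δ`). -/
def commut (L : FirstOrder.Language) (A : Type*) [L.Structure A] (α β : A → A → Prop) :
    A → A → Prop :=
  fun x y => ∀ δ : A → A → Prop, IsCong L A δ → TermCond L A α β δ → δ x y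

/-- An algebra is idempotent if every basic operation satisfies `f(a,…,a) = a`. -/
def IsIdem (L : FirstOrder.Language) (A : Type*) [L.Structure A] : Prop :=
  ∀ (n : ℕ) (f : L.Functions n) (a : A), funMap f (fun _ => a) = a

/-- A ternary term `d` is a difference term operation for `A` if `d(a,a,b) = b` and
`(a, d(a,b,b)) ∈ [θ,θ]` where `θ = Cg^A(a,b)`. -/
def IsDTO (L : FirstOrder.Language) (A : Type*) [L.Structure A] (d : L.Term (Fin 3)) : Prop :=
  ∀ a b : A, d.realize ![a, a, b] = b ∧
    commut L A (cgPair L A a b) (cgPair L A a b) a (d.realize ![a, b, b])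

/-- A local difference term operation for a triple `(a, b, i) ∈ A² × {0,1}`
(`i = 1` is encoded as `true`). -/
def IsLDTO (L : FirstOrder.Language) (A : Type*) [L.Structure A] (t : L.Term (Fin 3))
    (s : A × A × Bool) : Prop :=
  if s.2.2 then t.realize ![s.1, s.1, s.2.1] = s.2.1
  else commut L A (cgPair L A s.1 s.2.1) (cgPair L A s.1 s.2.1) s.1
    (t.realize ![s.1, s.2.1, s.2.1])

/-- The coordinatewise `L`-structure on a product. -/
def prodStructure (L : FirstOrder.Language) (A B : Type*) [L.Structure A] [L.Structure B] :
    L.Structure (A × B) where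
  funMap f x := (funMap f fun i => (x i).1, funMap f fun i => (x i).2)
  RelMap r x := RelMap r (fun i => (x i).1) ∧ RelMap r (fun i => (x i).2)

/-- The quotient structure on `Quotient s` induced by the structure on `A`. -/
noncomputable def quotStructure (L : FirstOrder.Language) (A : Type*) [L.Structure A] (s : Setoid A) :
    L.Structure (Quotient s) where
  funMap f x := ⟦funMap f fun i => (x i).out⟧
  RelMap r x := RelMap r fun i => (x i).out

/-- Congruences are preserved by term operations. -/
theorem IsCong.realize {L : FirstOrder.Language} {A : Type*} [L.Structure A] {r : A → A → Prop}
    (hr : IsCong L A r) {ι : Type*} (t : L.Term ι) {u v : ι → A} (h : ∀ i, r (u i) (v i)) :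
    r (t.realize u) (t.realize v) := by
  induction t with
  | var i => exact h i
  | func f ts ih => exact hr.2 _ f _ _ ih

/-- A ternary term operation preserves a congruence in each of its arguments. -/
theorem IsCong.realize₃ {L : FirstOrder.Language} {A : Type*} [L.Structure A]
    {r : A → A → Prop} (hr : IsCong L A r) (t : L.Term (Fin 3)) {a b c a' b' c' : A}
    (ha : r a a') (hb : r b b') (hc : r c c') :
    r (t.realize ![a, b, c]) (t.realize ![a', b', c']) :=
  hr.realize t fun i => by fin_cases i <;> assumption

/-- Term operations of an idempotent algebra are idempotent. -/
theorem IsIdem.realize_const {L : FirstOrder.Language} {A : Type*} [L.Structure A]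
    (h : IsIdem L A) {ι : Type*} (t : L.Term ι) (a : A) :
    t.realize (fun _ => a) = a := by
  induction t with
  | var i => rfl
  | func f ts ih => simp only [Term.realize_func, ih, h _ f a]

theorem IsIdem.realize₃ {L : FirstOrder.Language} {A : Type*} [L.Structure A]
    (h : IsIdem L A) (t : L.Term (Fin 3)) (a : A) : t.realize ![a, a, a] = a := by
  have e : ![a, a, a] = fun _ => a := by
    funext i
    fin_cases i <;> rfl
  rw [e, h.realize_const]

/-- The commutator is a congruence. -/
theorem isCong_commut {L : FirstOrder.Language} {A : Type*} [L.Structure A]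
    (α β : A → A → Prop) : IsCong L A (commut L A α β) :=
  ⟨⟨fun x _ hδ _ => hδ.1.refl x, fun h δ hδ ht => hδ.1.symm (h δ hδ ht),
    fun h h' δ hδ ht => hδ.1.trans (h δ hδ ht) (h' δ hδ ht)⟩,
    fun n f x y h δ hδ ht => hδ.2 n f x y fun i => h i δ hδ ht⟩

/-- The commutator is monotone in both arguments. -/
theorem commut_mono {L : FirstOrder.Language} {A : Type*} [L.Structure A]
    {α α' β β' : A → A → Prop} (hα : ∀ x y, α x y → α' x y) (hβ : ∀ x y, β x y → β' x y)
    {x y : A} (h : commut L A α β x y) : commut L A α' β' x y :=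
  fun δ hδ ht => h δ hδ fun n t a a' ha u v huv =>
    ht n t a a' (hα _ _ ha) u v fun i => hβ _ _ (huv i)

theorem cgPair_le {L : FirstOrder.Language} {A : Type*} [L.Structure A] {a b c d : A}
    (h : ∀ r, IsCong L A r → r a b → r c d) (x y : A) (hxy : cgPair L A c d x y) :
    cgPair L A a b x y := by
  intro r hr hab
  refine hxy r hr ?_
  rintro p rfl
  exact h r hr (hab (a, b) rfl)

theorem isLDTO_true {L : FirstOrder.Language} {A : Type*} [L.Structure A]
    {t : L.Term (Fin 3)} {a b : A} :
    IsLDTO L A t (a, b, true) ↔ t.realize ![a, a, b] = b := by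
  simp [IsLDTO]

theorem isLDTO_false {L : FirstOrder.Language} {A : Type*} [L.Structure A]
    {t : L.Term (Fin 3)} {a b : A} :
    IsLDTO L A t (a, b, false) ↔
      commut L A (cgPair L A a b) (cgPair L A a b) a (t.realize ![a, b, b]) := by
  simp [IsLDTO]

/-- Substitution of ternary terms into a ternary term. -/
def subst₃ {L : FirstOrder.Language} (q t₀ t₁ t₂ : L.Term (Fin 3)) : L.Term (Fin 3) :=
  q.subst ![t₀, t₁, t₂]

theorem realize_subst₃ {L : FirstOrder.Language} {A : Type*} [L.Structure A]
    (q t₀ t₁ t₂ : L.Term (Fin 3)) (v : Fin 3 → A) :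
    (subst₃ q t₀ t₁ t₂).realize v =
      q.realize ![t₀.realize v, t₁.realize v, t₂.realize v] := by
  rw [subst₃, Term.realize_subst]
  congr 1
  funext i
  fin_cases i <;> rfl

/-- `q(x, p(x,y,y), p(x,y,z))` is a local difference term operation at every triple `(c, d, 1)`
where both `p` and `q` are. -/
theorem IsLDTO.combine_true {L : FirstOrder.Language} {A : Type*} [L.Structure A]
    (hidem : IsIdem L A) {p q : L.Term (Fin 3)} {c d : A}
    (hp : IsLDTO L A p (c, d, true)) (hq : IsLDTO L A q (c, d, true)) :
    IsLDTO L A (subst₃ q (.var 0) (subst₃ p (.var 0) (.var 1) (.var 1)) p) (c, d, true) := by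
  rw [isLDTO_true] at *
  simp only [realize_subst₃, Term.realize_var, Matrix.cons_val]
  rw [hidem.realize₃, hp, hq]

/-- One triple `(c, d, 1)` and finitely many triples `(a, b, 0)` have a common local
difference term operation. -/
theorem exists_isLDTO_finset_false {L : FirstOrder.Language} {A : Type*} [L.Structure A]
    (hidem : IsIdem L A)
    (hpairs : ∀ s₀ s₁ : A × A × Bool,
      ∃ t : L.Term (Fin 3), IsLDTO L A t s₀ ∧ IsLDTO L A t s₁)
    (Z : Finset (A × A)) (c d : A) :
    ∃ t : L.Term (Fin 3), IsLDTO L A t (c, d, true) ∧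
      ∀ z ∈ Z, IsLDTO L A t (z.1, z.2, false) := by
  classical
  induction Z using Finset.induction_on with
  | empty => exact ⟨.var 2, by simp [isLDTO_true], by simp⟩
  | insert s Z _ ih =>
    obtain ⟨a, b⟩ := s
    obtain ⟨p, hp, hpZ⟩ := ih
    obtain ⟨q, hq, hqs⟩ := hpairs (c, d, true) (a, p.realize ![a, b, b], false)
    refine ⟨_, hp.combine_true hidem hq, fun z hz => ?_⟩
    rw [isLDTO_false]
    simp only [realize_subst₃, Term.realize_var, Matrix.cons_val]
    rcases Finset.mem_insert.1 hz with rfl | hz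
    · have hle := cgPair_le (L := L) (a := a) (b := b) (c := a) (d := p.realize ![a, b, b])
        fun r hr hab => by
          have := hr.realize₃ p (hr.1.refl a) hab hab
          rwa [hidem.realize₃] at this
      exact commut_mono hle hle (isLDTO_false.1 hqs)
    · have hC := isCong_commut (L := L) (cgPair L A z.1 z.2) (cgPair L A z.1 z.2)
      have h := isLDTO_false.1 (hpZ z hz)
      have := hC.realize₃ q (hC.1.refl z.1) h h
      rwa [hidem.realize₃] at this

/-- Finitely many triples `(c, d, 1)` and finitely many triples `(a, b, 0)` have a common local
difference term operation. -/
theorem exists_isLDTO_finset {L : FirstOrder.Language} {A : Type*} [L.Structure A]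
    (hidem : IsIdem L A)
    (hpairs : ∀ s₀ s₁ : A × A × Bool,
      ∃ t : L.Term (Fin 3), IsLDTO L A t s₀ ∧ IsLDTO L A t s₁)
    (Z O : Finset (A × A)) :
    ∃ t : L.Term (Fin 3), (∀ s ∈ O, IsLDTO L A t (s.1, s.2, true)) ∧
      ∀ z ∈ Z, IsLDTO L A t (z.1, z.2, false) := by
  classical
  induction O using Finset.induction_on with
  | empty =>
    refine ⟨.var 0, by simp, fun z _ => ?_⟩
    rw [isLDTO_false]
    exact (isCong_commut _ _).1.refl _
  | insert s O _ ih =>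
    obtain ⟨c, d⟩ := s
    obtain ⟨p, hpO, hpZ⟩ := ih
    obtain ⟨q, hq, hqZ⟩ := exists_isLDTO_finset_false hidem hpairs Z (p.realize ![c, c, d]) d
    rw [isLDTO_true] at hq
    refine ⟨subst₃ q p (subst₃ p (.var 1) (.var 1) (.var 2)) (.var 2), fun s hs => ?_,
      fun z hz => ?_⟩
    · rw [isLDTO_true]
      simp only [realize_subst₃, Term.realize_var, Matrix.cons_val]
      rcases Finset.mem_insert.1 hs with rfl | hs
      · exact hq
      · rw [isLDTO_true.1 (hpO s hs), hidem.realize₃]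
    · rw [isLDTO_false]
      simp only [realize_subst₃, Term.realize_var, Matrix.cons_val]
      rw [hidem.realize₃]
      have hC := isCong_commut (L := L) (cgPair L A z.1 z.2) (cgPair L A z.1 z.2)
      exact hC.1.trans (isLDTO_false.1 (hqZ z hz))
        (hC.realize₃ q (isLDTO_false.1 (hpZ z hz)) (hC.1.refl _) (hC.1.refl _))

theorem stmt1 {L : FirstOrder.Language} [L.IsAlgebraic] (A : Type*) [L.Structure A] [Finite A]
    (hidem : IsIdem L A)
    (hpairs : ∀ s₀ s₁ : A × A × Bool,
      ∃ t : L.Term (Fin 3), IsLDTO L A t s₀ ∧ IsLDTO L A t s₁) :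
    (∃ t : L.Term (Fin 3), ∀ s : A × A × Bool, IsLDTO L A t s) ∧
      (∀ t : L.Term (Fin 3), (∀ s : A × A × Bool, IsLDTO L A t s) → IsDTO L A t) ∧
      (∃ d : L.Term (Fin 3), IsDTO L A d) := by
  have := Fintype.ofFinite A
  have hex : ∃ t : L.Term (Fin 3), ∀ s : A × A × Bool, IsLDTO L A t s := by
    obtain ⟨t, h₁, h₀⟩ := exists_isLDTO_finset hidem hpairs Finset.univ Finset.univ
    refine ⟨t, ?_⟩
    rintro ⟨a, b, _ | _⟩
    · exact h₀ (a, b) (Finset.mem_univ _)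
    · exact h₁ (a, b) (Finset.mem_univ _)
  have hdto : ∀ t : L.Term (Fin 3), (∀ s : A × A × Bool, IsLDTO L A t s) → IsDTO L A t :=
    fun t ht a b => ⟨isLDTO_true.1 (ht (a, b, true)), isLDTO_false.1 (ht (a, b, false))⟩
  exact ⟨hex, hdto, hex.imp hdto⟩
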